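/- The lattice U(2) admits no primitive embedding into U ⊕ ⟨2⟩: there is no sublattice K of U ⊕ ⟨2⟩ such that the quotient (U ⊕ ⟨2⟩)/K is torsion-free and K is isometric to U(2). -/

import Mathlib

open Matrix

/-- The Gram pairing `(x, y) ↦ xᵀ G y` of an integer matrix `G`, as a bilinear map. -/
def gramBilin {n : ℕ} (G : Matrix (Fin n) (Fin n) ℤ) :
    (Fin n → ℤ) →ₗ[ℤ] (Fin n → ℤ) →ₗ[ℤ] ℤ :=
  Matrix.toLinearMap₂' ℤ G

/-- The hyperbolic plane `U`, with Gram matrix `[[0,1],[1,0]]`. -/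
def UGram : Matrix (Fin 2) (Fin 2) ℤ := !![0, 1; 1, 0]

/-- `U(2)`, with Gram matrix `[[0,2],[2,0]]`. -/
def U2Gram : Matrix (Fin 2) (Fin 2) ℤ := !![0, 2; 2, 0]

/-- The rank-one lattice `⟨k⟩`. -/
def rankOneGram (k : ℤ) : Matrix (Fin 1) (Fin 1) ℤ := !![k]

/-- Orthogonal direct sum of two bilinear forms, on the product module. -/
def prodBilin {M N : Type*} [AddCommGroup M] [AddCommGroup N] [Module ℤ M] [Module ℤ N]
    (BM : M →ₗ[ℤ] M →ₗ[ℤ] ℤ) (BN : N →ₗ[ℤ] N →ₗ[ℤ] ℤ) :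
    (M × N) →ₗ[ℤ] (M × N) →ₗ[ℤ] ℤ :=
  LinearMap.mk₂ ℤ (fun x y => BM x.1 y.1 + BN x.2 y.2)
    (by intro m₁ m₂ n; simp [map_add]; ring)
    (by intro c m n; simp [_root_.map_smul, smul_eq_mul]; ring)
    (by intro m n₁ n₂; simp [map_add]; ring)
    (by intro c m n; simp [_root_.map_smul, smul_eq_mul]; ring)

/-- The underlying module of the lattice `U ⊕ ⟨2⟩`. -/
abbrev UplusTwoM : Type := (Fin 2 → ℤ) × (Fin 1 → ℤ)

/-- The bilinear form of the lattice `U ⊕ ⟨2⟩`. -/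
def UplusTwoB : UplusTwoM →ₗ[ℤ] UplusTwoM →ₗ[ℤ] ℤ :=
  prodBilin (gramBilin UGram) (gramBilin (rankOneGram 2))

set_option synthInstance.maxSize 1000 in
/-- Modulo `4`, two isotropic vectors of `U ⊕ ⟨2⟩` whose product is `2` cannot both be nonzero
modulo `2`. -/
theorem zmod_four_isotropic_pair : ∀ a b c : ZMod 4, a * b + c * c = 0 →
    ∀ d e f : ZMod 4, d * e + f * f = 0 → a * e + b * d + 2 * (c * f) = 2 →
    (2 * a = 0 ∧ 2 * b = 0 ∧ 2 * c = 0) ∨ (2 * d = 0 ∧ 2 * e = 0 ∧ 2 * f = 0) := by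
  decide

theorem even_of_two_mul_zmod_four_eq_zero {a : ℤ} (h : 2 * (a : ZMod 4) = 0) :
    ∃ k, a = 2 * k := by
  have h' : ((2 * a : ℤ) : ZMod 4) = 0 := by exact_mod_cast h
  rw [ZMod.intCast_zmod_eq_zero_iff_dvd] at h'
  exact ⟨a / 2, by push_cast at h'; omega⟩

/-- Of two isotropic integral vectors of `U ⊕ ⟨2⟩` with product `2`, one is divisible by `2`. -/
theorem isotropic_pair_dvd_two {a b c d e f : ℤ} (hv : a * b + c * c = 0)
    (hw : d * e + f * f = 0) (hvw : a * e + b * d + 2 * (c * f) = 2) :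
    ((∃ k, a = 2 * k) ∧ (∃ k, b = 2 * k) ∧ (∃ k, c = 2 * k)) ∨
    ((∃ k, d = 2 * k) ∧ (∃ k, e = 2 * k) ∧ (∃ k, f = 2 * k)) := by
  have key := zmod_four_isotropic_pair a b c (by exact_mod_cast congrArg (Int.cast : ℤ → ZMod 4) hv)
    d e f (by exact_mod_cast congrArg (Int.cast : ℤ → ZMod 4) hw)
    (by exact_mod_cast congrArg (Int.cast : ℤ → ZMod 4) hvw)
  exact key.imp
    (fun h => ⟨even_of_two_mul_zmod_four_eq_zero h.1, even_of_two_mul_zmod_four_eq_zero h.2.1,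
      even_of_two_mul_zmod_four_eq_zero h.2.2⟩)
    (fun h => ⟨even_of_two_mul_zmod_four_eq_zero h.1, even_of_two_mul_zmod_four_eq_zero h.2.1,
      even_of_two_mul_zmod_four_eq_zero h.2.2⟩)

theorem UplusTwoB_apply (x y : UplusTwoM) :
    UplusTwoB x y = x.1 0 * y.1 1 + x.1 1 * y.1 0 + 2 * (x.2 0 * y.2 0) := by
  simp [UplusTwoB, prodBilin, gramBilin, UGram, rankOneGram, Matrix.toLinearMap₂'_apply,
    Fin.sum_univ_two]
  ring

theorem gramBilin_U2Gram_apply (x y : Fin 2 → ℤ) :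
    gramBilin U2Gram x y = 2 * (x 0 * y 1 + x 1 * y 0) := by
  simp [gramBilin, U2Gram, Matrix.toLinearMap₂'_apply, Fin.sum_univ_two]
  ring

/-- In a primitive sublattice with coordinates `e`, a vector divisible by `2` in the ambient lattice
has no coordinate equal to `1`. -/
theorem coord_ne_one_of_dvd_two {K : Submodule ℤ UplusTwoM}
    (hK : ∀ (x : UplusTwoM) (n : ℤ), n ≠ 0 → n • x ∈ K → x ∈ K)
    (e : K ≃ₗ[ℤ] (Fin 2 → ℤ)) (v : K)
    (h : (∃ k, (v : UplusTwoM).1 0 = 2 * k) ∧ (∃ k, (v : UplusTwoM).1 1 = 2 * k) ∧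
      (∃ k, (v : UplusTwoM).2 0 = 2 * k)) (i : Fin 2) : e v i ≠ 1 := by
  obtain ⟨⟨k, hk⟩, ⟨l, hl⟩, ⟨m, hm⟩⟩ := h
  have hv : (v : UplusTwoM) = (2 : ℤ) • ((![k, l], ![m]) : UplusTwoM) := by
    ext j <;> fin_cases j <;> simp [hk, hl, hm]
  have hx := hK _ 2 two_ne_zero (hv ▸ v.2)
  have hv' : v = (2 : ℤ) • (⟨_, hx⟩ : K) := Subtype.ext hv
  rw [hv', map_smul, Pi.smul_apply, smul_eq_mul]
  omega

/-- `U(2)` admits no primitive embedding into `U ⊕ ⟨2⟩`: there is no sublattice `K` of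
`U ⊕ ⟨2⟩` with torsion-free quotient which is isometric to `U(2)`. -/
theorem no_primitive_embedding_U2 :
    ¬ ∃ K : Submodule ℤ UplusTwoM,
      (∀ (x : UplusTwoM) (n : ℤ), n ≠ 0 → n • x ∈ K → x ∈ K) ∧
      ∃ e : K ≃ₗ[ℤ] (Fin 2 → ℤ),
        ∀ x y : K, gramBilin U2Gram (e x) (e y) = UplusTwoB (x : UplusTwoM) (y : UplusTwoM) := by
  rintro ⟨K, hK, e, he⟩
  have hB : ∀ x y : Fin 2 → ℤ, 2 * (x 0 * y 1 + x 1 * y 0) =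
      UplusTwoB (e.symm x : UplusTwoM) (e.symm y : UplusTwoM) := fun x y => by
    rw [← he, e.apply_symm_apply, e.apply_symm_apply, gramBilin_U2Gram_apply]
  have hv := hB ![1, 0] ![1, 0]
  have hw := hB ![0, 1] ![0, 1]
  have hvw := hB ![1, 0] ![0, 1]
  rw [UplusTwoB_apply] at hv hw hvw
  simp only [Matrix.cons_val_zero, Matrix.cons_val_one] at hv hw hvw
  rcases isotropic_pair_dvd_two
      (a := (e.symm ![1, 0] : UplusTwoM).1 0) (b := (e.symm ![1, 0] : UplusTwoM).1 1)
      (c := (e.symm ![1, 0] : UplusTwoM).2 0) (d := (e.symm ![0, 1] : UplusTwoM).1 0)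
      (e := (e.symm ![0, 1] : UplusTwoM).1 1) (f := (e.symm ![0, 1] : UplusTwoM).2 0)
      (by linarith) (by linarith) (by linarith) with h | h
  · exact coord_ne_one_of_dvd_two hK e _ h 0 (by simp)
  · exact coord_ne_one_of_dvd_two hK e _ h 1 (by simp)
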